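/- arXiv:2001.11058 — 2 statements merged into one kernel-verified Lean document; each statement's English description precedes it below -/
import Mathlib

section
/- Suppose that E is a coanalytic (Π¹₁) equivalence relation on an uncountable Borel set X ⊆ 2^ω. Then there is a perfect set Y ⊆ X such that E coincides on Y either with the total equivalence relation (all elements of Y are E-equivalent) or with equality (Y is a perfect partial E-transversal). If in addition E is a countable equivalence relation, then the total case is impossible, i.e., there is a perfect set Y ⊆ X whose elements are pairwise E-inequivalent. -/
open MeasureTheory

abbrev Cantor : Type := ℕ → Bool

/-- The equivalence relation `E₀`: eventual agreement. -/
def eZero (x y : Cantor) : Prop := {k | x k ≠ y k}.Finite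

/-- The equivalence relation `Eₑ`: the set of disagreements is finite with even cardinality. -/
def eEven (x y : Cantor) : Prop := {k | x k ≠ y k}.Finite ∧ Even ({k | x k ≠ y k}.ncard)

/-- A set is coanalytic (`Π¹₁`) iff its complement is analytic. -/
def IsCoanalytic {α : Type*} [TopologicalSpace α] (S : Set α) : Prop := AnalyticSet Sᶜ

/-- A perfect set: nonempty, closed, no isolated points. -/
def PerfectSet (X : Set Cantor) : Prop := Perfect X ∧ X.Nonempty

/-- `E` restricted to the Borel set `X` is smooth. -/
def RelSmoothOn (E : Cantor → Cantor → Prop) (X : Set Cantor) : Prop :=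
  ∃ f : X → Cantor, Measurable f ∧ ∀ x y : X, (E x y ↔ f x = f y)

/-- A Borel set is `E₀`-large iff `E₀` restricted to it is not smooth. -/
def E0Large (X : Set Cantor) : Prop := ¬ RelSmoothOn eZero X

/-- An `E₀`-array: strings `u n i` with equal positive lengths and `u n 0 ≠ u n 1`. -/
structure E0Array where
  u : ℕ → Bool → List Bool
  len_eq : ∀ n, (u n false).length = (u n true).length
  len_pos : ∀ n, 1 ≤ (u n false).length
  ne : ∀ n, u n false ≠ u n true

/-- The point `x_u^a = u 0 (a 0) ⌢ u 1 (a 1) ⌢ ⋯`. (Since every block has length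
at least one, the join of the first `m+1` blocks has length `> m`.) -/
def xua (U : E0Array) (a : Cantor) : Cantor := fun m =>
  (((List.range (m + 1)).map (fun n => U.u n (a n))).flatten).getD m false

/-- The canonical `E₀`-large set `D_u` determined by the array `u`. -/
def Du (U : E0Array) : Set Cantor := Set.range (xua U)

/-- A double-bubble system. -/
structure DBS (D E : Cantor → Cantor → Prop) : Prop where
  equivD : Equivalence D
  equivE : Equivalence E
  borelD : MeasurableSet {p : Cantor × Cantor | D p.1 p.2}
  borelE : MeasurableSet {p : Cantor × Cantor | E p.1 p.2}
  countableD : ∀ x, {y | D x y}.Countable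
  countableE : ∀ x, {y | E x y}.Countable
  sub : ∀ x y, D x y → E x y
  double : ∀ x, ∃ y, E x y ∧ ¬ D x y ∧ ∀ z, E x z → (D x z ∨ D y z)

/-- `⟨D,E⟩ ⊑ ⟨D',E'⟩`: extension of double-bubble systems. -/
def DBSle (D E D' E' : Cantor → Cantor → Prop) : Prop :=
  (∀ x y, D x y → D' x y) ∧ (∀ x y, E x y → E' x y) ∧
    (∀ x y, E x y → ¬ D x y → ¬ D' x y)


open Set Filter Topology

section BaireCategory

variable {α β : Type*} [TopologicalSpace α] [TopologicalSpace β]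

/-- In a second countable Baire space, every set has a Baire measurable hull inside its closure. -/
theorem exists_baireMeasurableSet_hull [BaireSpace α] [SecondCountableTopology α] (A : Set α) :
    ∃ B, BaireMeasurableSet B ∧ A ⊆ B ∧ B ⊆ closure A ∧
      ∀ H, BaireMeasurableSet H → A ⊆ H → IsMeagre (B \ H) := by
  set V : Set α := ⋃ U ∈ {U ∈ TopologicalSpace.countableBasis α | IsMeagre (A ∩ U)}, U with hV
  have hVo : IsOpen V := isOpen_biUnion fun U hU =>
    TopologicalSpace.isOpen_of_mem_countableBasis hU.1
  have hcount : {U ∈ TopologicalSpace.countableBasis α | IsMeagre (A ∩ U)}.Countable :=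
    (TopologicalSpace.countable_countableBasis α).mono fun U hU => hU.1
  have hAV : IsMeagre (A ∩ V) := by
    rw [hV, inter_iUnion₂]
    exact isMeagre_biUnion hcount fun U hU => hU.2
  have hB : BaireMeasurableSet (closure A \ V ∪ A ∩ V) :=
    (isClosed_closure.isOpen_compl.baireMeasurableSet.of_compl.diff
      hVo.baireMeasurableSet).union hAV.baireMeasurableSet
  refine ⟨closure A \ V ∪ A ∩ V, hB, ?_, ?_, ?_⟩
  · intro x hx
    by_cases h : x ∈ V
    · exact .inr ⟨hx, h⟩
    · exact .inl ⟨subset_closure hx, h⟩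
  · exact union_subset sdiff_subset (inter_subset_left.trans subset_closure)
  · intro H hH hAH
    set K := (closure A \ V ∪ A ∩ V) \ H with hK
    obtain ⟨U, hUo, hKU⟩ := (hB.diff hH).residualEq_isOpen
    rw [eventuallyEq_set] at hKU
    have hUK : IsMeagre (U \ K) := by
      rw [IsMeagre]
      filter_upwards [hKU] with x hx hx'
      exact hx'.2 (hx.2 hx'.1)
    rcases U.eq_empty_or_nonempty with rfl | hne
    · rw [IsMeagre]
      filter_upwards [hKU] with x hx hx'
      exact hx.1 hx'
    · exfalso
      have hne' : (U ∩ K).Nonempty := by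
        by_contra hemp
        refine not_isMeagre_of_isOpen hUo hne (hUK.mono ?_)
        intro x hx
        exact ⟨hx, fun hxK => hemp ⟨x, hx, hxK⟩⟩
      obtain ⟨y, hyU, hyB, hyH⟩ := hne'
      have hyV : y ∉ V := by
        rcases hyB with h | h
        · exact h.2
        · exact absurd (hAH h.1) hyH
      have hycl : y ∈ closure A := by
        rcases hyB with h | h
        · exact h.1
        · exact absurd (hAH h.1) hyH
      obtain ⟨W, hW, hyW, hWU⟩ :=
        (TopologicalSpace.isBasis_countableBasis α).exists_subset_of_mem_open hyU hUo
      refine hyV (mem_biUnion (x := W) ⟨hW, hUK.mono ?_⟩ hyW)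
      intro x hx
      exact ⟨hWU hx.2, fun hxK => hxK.2 (hAH hx.1)⟩

/-- Analytic sets have the Baire property. -/
theorem MeasureTheory.AnalyticSet.baireMeasurableSet [BaireSpace α] [SecondCountableTopology α]
    [T2Space α] {A : Set α} (hA : AnalyticSet A) : BaireMeasurableSet A := by
  rw [AnalyticSet] at hA
  rcases hA with rfl | ⟨f, hf, rfl⟩
  · exact isOpen_empty.baireMeasurableSet
  let N : List ℕ → Set (ℕ → ℕ) := fun l => {x | PiNat.res x l.length = l}
  choose B hBm hAB hBcl hBhull using fun l => exists_baireMeasurableSet_hull (f '' N l)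
  have hsub : ∀ l, f '' N l ⊆ ⋃ n, B (n :: l) := by
    rintro l _ ⟨x, hx, rfl⟩
    refine mem_iUnion.2 ⟨x l.length, hAB _ ⟨x, ?_, rfl⟩⟩
    simpa [N, PiNat.res_succ] using hx
  have hmeagre : IsMeagre (⋃ l, B l \ ⋃ n, B (n :: l)) :=
    isMeagre_iUnion fun l => hBhull l _ (.iUnion fun n => hBm _) (hsub l)
  have hrange : range f ⊆ B [] := by
    rintro _ ⟨x, rfl⟩
    exact hAB _ ⟨x, rfl, rfl⟩
  have hdiff : B [] \ range f ⊆ ⋃ l, B l \ ⋃ n, B (n :: l) := by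
    rintro y ⟨hy, hyf⟩
    by_contra hcon
    have hstep : ∀ l, ∃ n, y ∈ B l → y ∈ B (n :: l) := by
      intro l
      by_contra! h
      exact hcon (mem_iUnion.2 ⟨l, (h 0).1, fun hU => by
        obtain ⟨n, hn⟩ := mem_iUnion.1 hU
        exact (h n).2 hn⟩)
    choose nxt hnxt using hstep
    let L : ℕ → List ℕ := fun k => Nat.rec [] (fun _ l => nxt l :: l) k
    have hL : ∀ k, y ∈ B (L k) := by
      intro k
      induction k with
      | zero => exact hy
      | succ k ih => exact hnxt _ ih
    let x : ℕ → ℕ := fun k => nxt (L k)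
    have hres : ∀ k, PiNat.res x k = L k := by
      intro k
      induction k with
      | zero => rfl
      | succ k ih => rw [PiNat.res_succ, ih]
    have hyx : y ≠ f x := fun h => hyf ⟨x, h.symm⟩
    obtain ⟨U, V, hU, hV, hyU, hxV, hUV⟩ := t2_separation hyx
    obtain ⟨k, hk⟩ : ∃ k, PiNat.cylinder x k ⊆ f ⁻¹' V := by
      obtain ⟨_, ⟨z, k, rfl⟩, hxz, hzV⟩ :=
        (PiNat.isTopologicalBasis_cylinders (fun _ : ℕ => ℕ)).exists_subset_of_mem_open
          (show x ∈ f ⁻¹' V from hxV) (hV.preimage hf)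
      exact ⟨k, (PiNat.mem_cylinder_iff_eq.1 hxz) ▸ hzV⟩
    have hlen : (L k).length = k := by rw [← hres k, PiNat.res_length]
    obtain ⟨_, hzU, z, hz, rfl⟩ := mem_closure_iff.1 (hBcl _ (hL k)) U hU hyU
    refine hUV.le_bot ⟨hzU, hk ?_⟩
    rw [PiNat.cylinder_eq_res]
    simpa [N, hlen, hres] using hz
  have : range f = B [] \ (B [] \ range f) := by
    rw [sdiff_sdiff_cancel_left hrange]
  rw [this]
  exact (hBm _).diff (hmeagre.mono hdiff).baireMeasurableSet

/-- One direction of the Kuratowski–Ulam theorem. -/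
theorem eventually_residual_section_mem_residual [SecondCountableTopology β] {R : Set (α × β)}
    (hR : R ∈ residual (α × β)) : ∀ᶠ x in residual α, {y | (x, y) ∈ R} ∈ residual β := by
  obtain ⟨S, hSo, hSd, hSc, hSR⟩ := mem_residual_iff.1 hR
  have key : ∀ D ∈ S, ∀ᶠ x in residual α, {y | (x, y) ∈ D} ∈ residual β := by
    intro D hD
    have hW : ∀ W ∈ TopologicalSpace.countableBasis β,
        ∀ᶠ x in residual α, ∃ y ∈ W, (x, y) ∈ D := by
      intro W hW
      have hWo := TopologicalSpace.isOpen_of_mem_countableBasis hW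
      have himg : {x | ∃ y ∈ W, (x, y) ∈ D} = Prod.fst '' (D ∩ univ ×ˢ W) := by
        ext x
        simp [and_comm]
      refine residual_of_dense_open ?_ ?_
      · rw [himg]
        exact isOpenMap_fst _ ((hSo D hD).inter (isOpen_univ.prod hWo))
      · refine dense_iff_inter_open.2 fun V hV hVne => ?_
        obtain ⟨p, ⟨hpV, hpW⟩, hpD⟩ := (hSd D hD).inter_open_nonempty (V ×ˢ W) (hV.prod hWo)
          (hVne.prod (TopologicalSpace.nonempty_of_mem_countableBasis hW))
        exact ⟨p.1, hpV, p.2, hpW, hpD⟩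
    have hall := (eventually_countable_ball (TopologicalSpace.countable_countableBasis β)).2 hW
    filter_upwards [hall] with x hx
    refine residual_of_dense_open ((hSo D hD).preimage (by fun_prop)) ?_
    refine (TopologicalSpace.isBasis_countableBasis β).dense_iff.2 fun W hW _ => ?_
    obtain ⟨y, hy, hyD⟩ := hx W hW
    exact ⟨y, hy, hyD⟩
  filter_upwards [(eventually_countable_ball hSc).2 key] with x hx
  refine mem_of_superset ((countable_sInter_mem
    (hSc.image fun D => {y | (x, y) ∈ D})).2 ?_) ?_ (x := ⋂₀ ((fun D => {y | (x, y) ∈ D}) '' S))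
  · rintro _ ⟨D, hD, rfl⟩
    exact hx D hD
  · intro y hy
    exact hSR (mem_sInter.2 fun D hD => hy _ ⟨D, hD, rfl⟩)

end BaireCategory

/-- A tuple indexed by a finite type can be perturbed so that its distinct entries are pairwise
related by a given dense open relation. -/
theorem dense_setOf_pairwise_mem {β ι : Type*} [TopologicalSpace β] [Finite ι]
    {D : Set (β × β)} (hDo : IsOpen D) (hDd : Dense D) :
    Dense {v : ι → β | ∀ i j, i ≠ j → (v i, v j) ∈ D} := by
  classical
  have hopen : ∀ i j : ι, IsOpen {v : ι → β | (v i, v j) ∈ D} := fun i j =>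
    hDo.preimage (by fun_prop)
  have hdense : ∀ i j : ι, i ≠ j → Dense {v : ι → β | (v i, v j) ∈ D} := by
    intro i j hij
    refine dense_iff_inter_open.2 fun O hO ⟨v, hv⟩ => ?_
    let g : β × β → ι → β := fun p => Function.update (Function.update v i p.1) j p.2
    have hg : Continuous g := by fun_prop
    have hgv : g (v i, v j) = v := by simp [g]
    obtain ⟨p, hpO, hpD⟩ := hDd.inter_open_nonempty (g ⁻¹' O) (hO.preimage hg)
      ⟨(v i, v j), by rw [mem_preimage, hgv]; exact hv⟩
    refine ⟨g p, hpO, ?_⟩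
    simpa [g, hij] using hpD
  have hset : {v : ι → β | ∀ i j, i ≠ j → (v i, v j) ∈ D} =
      ⋂₀ ((fun q : ι × ι => {v : ι → β | (v q.1, v q.2) ∈ D}) '' {q | q.1 ≠ q.2}) := by
    ext v
    simp
  rw [hset]
  refine ((toFinite _).image _).dense_sInter ?_ ?_
  · rintro _ ⟨q, -, rfl⟩
    exact hopen _ _
  · rintro _ ⟨q, hq, rfl⟩
    exact hdense _ _ hq

/-- A continuous map from the Cantor space to a metric space oscillates little on all cylinders
of sufficiently large length. -/
theorem exists_forall_cylinder_dist_lt {β : Type*} [PseudoMetricSpace β] (f : C(ℕ → Bool, β))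
    {ε : ℝ} (hε : 0 < ε) (m : ℕ) :
    ∃ M ≥ m, ∀ x y : ℕ → Bool, (∀ i < M, x i = y i) → dist (f x) (f y) < ε := by
  let : MetricSpace (ℕ → Bool) := PiNat.metricSpaceOfDiscreteUniformity fun _ => rfl
  obtain ⟨δ, hδ, h⟩ := Metric.uniformContinuous_iff.1
    (CompactSpace.uniformContinuous_of_continuous f.continuous) ε hε
  obtain ⟨M, hM⟩ := exists_pow_lt_of_lt_one hδ (by norm_num : (1 / 2 : ℝ) < 1)
  refine ⟨max M m, le_max_right _ _, fun x y hxy => h (lt_of_le_of_lt ?_ hM)⟩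
  refine PiNat.mem_cylinder_iff_dist_le.1 fun i hi => hxy i (lt_of_lt_of_le hi (le_max_left _ _))

/-- **Mycielski's theorem**: every comeagre relation on a complete metric space contains all pairs
of distinct elements of a continuous family indexed by the Cantor space. -/
theorem exists_continuousMap_forall_ne_mem_of_mem_residual {β : Type*} [MetricSpace β]
    [CompleteSpace β] [Nonempty β] {R : Set (β × β)} (hR : R ∈ residual (β × β)) :
    ∃ f : C(ℕ → Bool, β), ∀ x y, x ≠ y → (f x, f y) ∈ R := by
  obtain ⟨S, hSo, hSd, hSc, hSR⟩ := mem_residual_iff.1 hR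
  let K : ℕ → Set ((ℕ → Bool) × (ℕ → Bool)) := fun m => {p | ∃ i < m, p.1 i ≠ p.2 i}
  have hK : ∀ m, IsCompact (K m) := by
    intro m
    have : K m = ⋃ i ∈ Iio m, {p | p.1 i ≠ p.2 i} := by
      ext p
      simp [K]
    rw [this]
    refine (finite_Iio m).isCompact_biUnion fun i _ => IsClosed.isCompact ?_
    exact (isClosed_discrete {q : Bool × Bool | q.1 ≠ q.2}).preimage
      (f := fun p : (ℕ → Bool) × (ℕ → Bool) => (p.1 i, p.2 i)) (by fun_prop)
  have key : ∀ D ∈ S, ∀ m, ∀ᶠ f : C(ℕ → Bool, β) in residual _,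
      MapsTo (f.prodMap f) (K m) D := by
    intro D hD m
    refine residual_of_dense_open ?_ ?_
    · have hcont : Continuous fun f : C(ℕ → Bool, β) => f.prodMap f := by
        refine ContinuousMap.continuous_of_continuous_uncurry _ ?_
        change Continuous fun q : C(ℕ → Bool, β) × ((ℕ → Bool) × (ℕ → Bool)) =>
          (q.1 q.2.1, q.1 q.2.2)
        fun_prop
      exact (ContinuousMap.isOpen_setOfPred_mapsTo (hK m) (hSo D hD)).preimage hcont
    · refine Metric.dense_iff.2 fun f ε hε => ?_
      obtain ⟨M, hmM, hM⟩ := exists_forall_cylinder_dist_lt f (half_pos hε) m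
      let r : (ℕ → Bool) → Fin M → Bool := fun x i => x i
      let e : (Fin M → Bool) → ℕ → Bool := fun s i => if h : i < M then s ⟨i, h⟩ else false
      obtain ⟨v, hv, hvD⟩ := (dense_setOf_pairwise_mem (ι := Fin M → Bool) (hSo D hD)
        (hSd D hD)).exists_dist_lt (fun s => f (e s)) (half_pos hε)
      have hr : Continuous r := by fun_prop
      refine ⟨⟨v ∘ r, continuous_of_discreteTopology.comp hr⟩, ?_, ?_⟩
      · rw [Metric.mem_ball, dist_comm, ContinuousMap.dist_lt_iff hε]
        intro x
        have h1 : dist (f x) (f (e (r x))) < ε / 2 := hM _ _ fun i hi => by simp [e, r, hi]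
        have h2 : dist (f (e (r x))) (v (r x)) < ε / 2 :=
          (dist_le_pi_dist (fun s => f (e s)) v (r x)).trans_lt hvD
        calc dist (f x) (v (r x)) ≤ _ := dist_triangle _ (f (e (r x))) _
          _ < ε := by linarith
      · rintro ⟨x, y⟩ ⟨i, hi, hxy⟩
        refine hv _ _ fun h => hxy ?_
        exact congrFun h ⟨i, hi.trans_le hmM⟩
  have hall : ∀ᶠ f : C(ℕ → Bool, β) in residual _, ∀ D ∈ S, ∀ m,
      MapsTo (f.prodMap f) (K m) D :=
    (eventually_countable_ball hSc).2 fun D hD => eventually_countable_forall.2 (key D hD)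
  have : Nonempty C(ℕ → Bool, β) := ⟨.const _ (Classical.arbitrary β)⟩
  obtain ⟨f, hf⟩ := (dense_of_mem_residual hall).nonempty
  refine ⟨f, fun x y hxy => hSR (mem_sInter.2 fun D hD => ?_)⟩
  obtain ⟨i, hi⟩ := Function.ne_iff.1 hxy
  exact hf D hD (i + 1) (x := (x, y)) ⟨i, i.lt_succ_self, hi⟩

instance perfectSpace_natBool : PerfectSpace (ℕ → Bool) := by
  refine ⟨fun x _ => accPt_iff_nhds.2 fun U hU => ?_⟩
  have hlim : Tendsto (fun n => Function.update x n (!x n)) atTop (𝓝 x) := by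
    refine tendsto_pi_nhds.2 fun i => tendsto_const_nhds.congr' ?_
    filter_upwards [eventually_gt_atTop i] with n hn
    simp [Function.update_of_ne hn.ne]
  obtain ⟨n, hn⟩ := (hlim.eventually hU).exists
  refine ⟨_, ⟨hn, mem_univ _⟩, fun h => ?_⟩
  simpa using congrFun h n

instance polishSpace_natBool : PolishSpace (ℕ → Bool) :=
  have : TopologicalSpace.IsCompletelyMetrizableSpace (ℕ → Bool) :=
    TopologicalSpace.IsCompletelyMetrizableSpace.pi_countable
  inferInstance

theorem perfectSet_range {f : Cantor → Cantor} (hf : Continuous f) (hinj : Function.Injective f) :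
    PerfectSet (range f) := by
  refine ⟨⟨(isCompact_range hf).isClosed, ?_⟩, range_nonempty f⟩
  rintro _ ⟨a, rfl⟩
  refine accPt_iff_nhds.2 fun U hU => ?_
  obtain ⟨b, ⟨hb, -⟩, hba⟩ := accPt_iff_nhds.1
    (PerfectSpace.univ_preperfect a (mem_univ a)) _ (hf.continuousAt hU)
  exact ⟨f b, ⟨hb, b, rfl⟩, hinj.ne hba⟩

/-- An uncountable Borel subset of a Polish space contains a continuous injective image of the
Cantor space. -/
theorem MeasurableSet.exists_nat_bool_injection_of_not_countable {α : Type*} [TopologicalSpace α]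
    [PolishSpace α] [MeasurableSpace α] [BorelSpace α] {s : Set α} (hs : MeasurableSet s)
    (hunc : ¬ s.Countable) :
    ∃ f : (ℕ → Bool) → α, range f ⊆ s ∧ Continuous f ∧ Function.Injective f := by
  obtain ⟨t, hle, hpol, hcl, -⟩ := hs.isClopenable
  obtain ⟨f, hfs, hf, hinj⟩ :=
    @IsClosed.exists_nat_bool_injection_of_not_countable α t hpol s hcl hunc
  exact ⟨f, hfs, continuous_le_rng hle hf, hinj⟩

theorem Set.Countable.isMeagre {α : Type*} [TopologicalSpace α] [T1Space α] [PerfectSpace α]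
    {s : Set α} (hs : s.Countable) : IsMeagre s := by
  rw [← biUnion_of_singleton s]
  refine isMeagre_biUnion hs fun x _ => ?_
  have : (𝓝[≠] x).NeBot := inferInstance
  exact residual_of_dense_open isOpen_compl_singleton (dense_compl_singleton x)

/-- A comeagre subset of a nonempty open set contains a continuous injective image of the
Cantor space. -/
theorem exists_nat_bool_injection_of_mem_residual {α : Type*} [TopologicalSpace α]
    [PolishSpace α] [PerfectSpace α] {W C : Set α} (hW : IsOpen W) (hne : W.Nonempty)
    (hC : {y | y ∈ W → y ∈ C} ∈ residual α) :
    ∃ f : (ℕ → Bool) → α, range f ⊆ C ∧ Continuous f ∧ Function.Injective f := by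
  borelize α
  obtain ⟨G, hGC, hG, hGd⟩ := mem_residual.1 hC
  have hunc : ¬ (W ∩ G).Countable := by
    intro hcount
    refine not_isMeagre_of_isOpen hW hne ?_
    have hGm : IsMeagre Gᶜ := by
      rw [IsMeagre, compl_compl]
      exact residual_of_dense_Gδ hG hGd
    refine (hcount.isMeagre.union hGm).mono fun x hx => ?_
    by_cases h : x ∈ G
    · exact .inl ⟨hx, h⟩
    · exact .inr h
  obtain ⟨f, hf, h⟩ :=
    (hW.measurableSet.inter hG.measurableSet).exists_nat_bool_injection_of_not_countable hunc
  exact ⟨f, hf.trans fun y hy => hGC hy.2 hy.1, h⟩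

theorem Perfect.not_countable {Y : Set Cantor} (hY : Perfect Y) (hne : Y.Nonempty) :
    ¬ Y.Countable := by
  let : MetricSpace (ℕ → Bool) := PiNat.metricSpaceOfDiscreteUniformity fun _ => rfl
  obtain ⟨f, hf, -, hinj⟩ := hY.exists_nat_bool_injection hne
  intro hc
  have huniv : f ⁻¹' Y = univ := eq_univ_of_forall fun x => hf (mem_range_self x)
  have := hc.preimage_of_injOn (f := f) hinj.injOn
  rw [huniv] at this
  exact not_isMeagre_of_isOpen isOpen_univ univ_nonempty this.isMeagre

theorem exists_perfectSet_total_or_transversal {X : Set Cantor} (hX : MeasurableSet X)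
    (hXu : ¬ X.Countable) {E : Cantor → Cantor → Prop}
    (hrefl : ∀ x ∈ X, E x x)
    (hsymm : ∀ x ∈ X, ∀ y ∈ X, E x y → E y x)
    (htrans : ∀ x ∈ X, ∀ y ∈ X, ∀ z ∈ X, E x y → E y z → E x z)
    (hco : IsCoanalytic {p : Cantor × Cantor | p.1 ∈ X ∧ p.2 ∈ X ∧ E p.1 p.2}) :
    ∃ Y, Y ⊆ X ∧ PerfectSet Y ∧
      ((∀ x ∈ Y, ∀ y ∈ Y, E x y) ∨ (∀ x ∈ Y, ∀ y ∈ Y, x ≠ y → ¬ E x y)) := by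
  obtain ⟨φ, hφX, hφ, hφi⟩ := hX.exists_nat_bool_injection_of_not_countable hXu
  have hmem : ∀ a, φ a ∈ X := fun a => hφX ⟨a, rfl⟩
  let R : Set (Cantor × Cantor) := {p | E (φ p.1) (φ p.2)}
  have hR : BaireMeasurableSet R := by
    have hpre := AnalyticSet.preimage hco
      (f := fun p : Cantor × Cantor => (φ p.1, φ p.2)) (by fun_prop)
    refine BaireMeasurableSet.of_compl ?_
    convert! hpre.baireMeasurableSet using 1
    ext p
    simp [R, hmem]
  obtain ⟨U, hU, hRU⟩ := hR.residualEq_isOpen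
  rw [eventuallyEq_set] at hRU
  rcases U.eq_empty_or_nonempty with rfl | ⟨p, hp⟩
  · let : MetricSpace (ℕ → Bool) := PiNat.metricSpaceOfDiscreteUniformity fun _ => rfl
    have hres : Rᶜ ∈ residual (Cantor × Cantor) := by
      filter_upwards [hRU] with q hq hq'
      exact hq.1 hq'
    obtain ⟨f, hf⟩ := exists_continuousMap_forall_ne_mem_of_mem_residual hres
    have hinj : Function.Injective f := by
      intro x y hxy
      by_contra hne
      exact hf x y hne (by simpa [R, hxy] using hrefl _ (hmem _))
    refine ⟨range (φ ∘ f), ?_, perfectSet_range (hφ.comp f.continuous) (hφi.comp hinj), .inr ?_⟩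
    · rintro _ ⟨a, rfl⟩
      exact hmem _
    · rintro _ ⟨a, rfl⟩ _ ⟨b, rfl⟩ hab
      exact hf a b fun h => hab (by rw [h])
  · have hUR : {q | q ∈ U → q ∈ R} ∈ residual (Cantor × Cantor) := by
      filter_upwards [hRU] with q hq
      exact hq.2
    obtain ⟨a, ⟨⟨a, b⟩, hab, rfl⟩, ha⟩ :=
      (dense_of_mem_residual (eventually_residual_section_mem_residual hUR)).inter_open_nonempty
        (Prod.fst '' U) (isOpenMap_fst _ hU) ⟨p.1, p, hp, rfl⟩
    obtain ⟨f, hfC, hf, hinj⟩ := exists_nat_bool_injection_of_mem_residual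
      (W := {y | (a, y) ∈ U}) (C := {y | (a, y) ∈ R}) (hU.preimage (by fun_prop)) ⟨b, hab⟩ ha
    refine ⟨range (φ ∘ f), ?_, perfectSet_range (hφ.comp hf) (hφi.comp hinj), .inl ?_⟩
    · rintro _ ⟨x, rfl⟩
      exact hmem _
    · rintro _ ⟨x, rfl⟩ _ ⟨y, rfl⟩
      exact htrans _ (hmem _) _ (hmem a) _ (hmem _)
        (hsymm _ (hmem _) _ (hmem _) (hfC ⟨x, rfl⟩)) (hfC ⟨y, rfl⟩)

/-- On an uncountable Borel set, a coanalytic equivalence relation coincides on some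
perfect subset either with the total relation or with equality; if moreover the
relation is countable, the total case is impossible. -/
theorem silver_canonization (X : Set Cantor) (hX : MeasurableSet X)
    (hXu : ¬ X.Countable)
    (E : Cantor → Cantor → Prop)
    (hrefl : ∀ x ∈ X, E x x)
    (hsymm : ∀ x ∈ X, ∀ y ∈ X, E x y → E y x)
    (htrans : ∀ x ∈ X, ∀ y ∈ X, ∀ z ∈ X, E x y → E y z → E x z)
    (hco : IsCoanalytic {p : Cantor × Cantor | p.1 ∈ X ∧ p.2 ∈ X ∧ E p.1 p.2}) :
    (∃ Y, Y ⊆ X ∧ PerfectSet Y ∧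
      ((∀ x ∈ Y, ∀ y ∈ Y, E x y) ∨ (∀ x ∈ Y, ∀ y ∈ Y, x ≠ y → ¬ E x y))) ∧
    ((∀ x ∈ X, {y ∈ X | E x y}.Countable) →
      ∃ Y, Y ⊆ X ∧ PerfectSet Y ∧ ∀ x ∈ Y, ∀ y ∈ Y, x ≠ y → ¬ E x y) := by
  refine ⟨exists_perfectSet_total_or_transversal hX hXu hrefl hsymm htrans hco, fun hc => ?_⟩
  obtain ⟨Y, hYX, hY, htot | htr⟩ :=
    exists_perfectSet_total_or_transversal hX hXu hrefl hsymm htrans hco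
  · obtain ⟨x, hx⟩ := hY.2
    have hsub : Y ⊆ {y ∈ X | E x y} := fun y hy => ⟨hYX hy, htot x hx y hy⟩
    exact absurd ((hc x (hYX hx)).mono hsub) (hY.1.not_countable hY.2)
  · exact ⟨Y, hYX, hY, htr⟩
end

section
/- If X ⊆ 2^ω is a Borel E₀-large set and Z ⊆ X is a Borel set, then there is a canonical E₀-large set Y ⊆ X such that either Y ⊆ Z or Y ∩ Z = ∅. -/
open MeasureTheory

open Set Filter Topology

/-- Flip the coordinates of `x` that lie in the finite set `g`. -/
def flipOn (g : Finset ℕ) (x : Cantor) : Cantor := fun k => xor (x k) (decide (k ∈ g))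

lemma flipOn_empty (x : Cantor) : flipOn ∅ x = x := by
  funext k; simp [flipOn]

lemma flipOn_symmDiff (g h : Finset ℕ) (x : Cantor) :
    flipOn (symmDiff g h) x = flipOn g (flipOn h x) := by
  funext k
  by_cases hg : k ∈ g <;> by_cases hh : k ∈ h <;> simp [flipOn, Finset.mem_symmDiff, hg, hh]

lemma flipOn_flipOn (g : Finset ℕ) (x : Cantor) : flipOn g (flipOn g x) = x := by
  rw [← flipOn_symmDiff, symmDiff_self]; exact flipOn_empty x

lemma image_flipOn (g : Finset ℕ) (s : Set Cantor) : flipOn g '' s = flipOn g ⁻¹' s :=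
  congrFun (image_eq_preimage_of_inverse (flipOn_flipOn g) (flipOn_flipOn g)) s

lemma measurable_flipOn (g : Finset ℕ) : Measurable (flipOn g) := by
  refine measurable_pi_lambda _ fun k => ?_
  exact (measurable_of_finite fun b : Bool => xor b (decide (k ∈ g))).comp (measurable_pi_apply k)

lemma measurableSet_image_flipOn (g : Finset ℕ) {s : Set Cantor} (hs : MeasurableSet s) :
    MeasurableSet (flipOn g '' s) := by
  rw [image_flipOn]; exact measurable_flipOn g hs

lemma eZero_flipOn (g : Finset ℕ) (x : Cantor) : eZero x (flipOn g x) := by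
  refine g.finite_toSet.subset fun k hk => ?_
  by_contra h
  exact hk (by simp_all [flipOn])

lemma eZero.symm {x y : Cantor} (h : eZero x y) : eZero y x := by
  simpa only [eZero, ne_comm] using h

lemma eZero.trans {x y z : Cantor} (h : eZero x y) (h' : eZero y z) : eZero x z := by
  refine (h.union h').subset fun k hk => ?_
  by_contra hc
  simp only [mem_union, mem_ofPred_eq, not_or, not_not] at hc
  exact hk (hc.1.trans hc.2)

lemma eZero.exists_flipOn {x y : Cantor} (h : eZero x y) :
    ∃ g : Finset ℕ, flipOn g x = y ∧ ∀ k ∈ g, x k ≠ y k := by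
  have hmem : ∀ k, k ∈ Finite.toFinset h ↔ x k ≠ y k := fun k => Finite.mem_toFinset h
  refine ⟨Finite.toFinset h, ?_, fun k hk => (hmem k).1 hk⟩
  funext k
  simp only [flipOn, hmem]
  cases x k <;> cases y k <;> simp

/-- `B` is covered by countably many Borel partial transversals of `E₀`. -/
def E0Null (B : Set Cantor) : Prop :=
  ∃ T : ℕ → Set Cantor, (∀ n, MeasurableSet (T n)) ∧
    (∀ n, ∀ x ∈ T n, ∀ y ∈ T n, eZero x y → x = y) ∧ B ⊆ ⋃ n, T n

lemma E0Null.mono {A B : Set Cantor} (hB : E0Null B) (h : A ⊆ B) : E0Null A := by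
  obtain ⟨T, h1, h2, h3⟩ := hB
  exact ⟨T, h1, h2, h.trans h3⟩

lemma E0Null.iUnion {ι : Type*} [Countable ι] {B : ι → Set Cantor} (hB : ∀ i, E0Null (B i)) :
    E0Null (⋃ i, B i) := by
  choose T h1 h2 h3 using hB
  rcases isEmpty_or_nonempty ι with hι | hι
  · exact ⟨fun _ => ∅, by simp, by simp, by simp⟩
  obtain ⟨e, he⟩ := exists_surjective_nat (ι × ℕ)
  refine ⟨fun n => T (e n).1 (e n).2, fun n => h1 _ _, fun n => h2 _ _, ?_⟩
  refine iUnion_subset fun i x hx => ?_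
  obtain ⟨n, hn⟩ := mem_iUnion.1 (h3 i hx)
  obtain ⟨k, hk⟩ := he (i, n)
  exact mem_iUnion.2 ⟨k, by simpa [hk] using hn⟩

lemma E0Null.union {A B : Set Cantor} (hA : E0Null A) (hB : E0Null B) : E0Null (A ∪ B) := by
  rw [union_eq_iUnion]
  exact E0Null.iUnion fun b => by cases b <;> simpa

lemma E0Null.relSmoothOn {X : Set Cantor} (hX : E0Null X) : RelSmoothOn eZero X := by
  classical
  obtain ⟨T, hT, hinj, hcov⟩ := hX
  let A : ℕ → Set Cantor := fun n => ⋃ g, flipOn g ⁻¹' T n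
  have hA : ∀ n, MeasurableSet (A n) := fun n =>
    MeasurableSet.iUnion fun g => measurable_flipOn g (hT n)
  have hAinv : ∀ {x y : Cantor}, eZero x y → ∀ n, x ∈ A n → y ∈ A n := by
    intro x y hxy n hx
    obtain ⟨g, hg⟩ := mem_iUnion.1 hx
    obtain ⟨h, hh, -⟩ := (hxy.symm.trans (eZero_flipOn g x)).exists_flipOn
    exact mem_iUnion.2 ⟨h, by simpa [hh] using hg⟩
  have key : ∀ x : X, ∃ y n, (x.1 ∈ A n ∧ ∀ m < n, x.1 ∉ A m) ∧ y ∈ T n ∧ eZero x.1 y := by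
    intro x
    have hex : ∃ n, x.1 ∈ A n := by
      obtain ⟨n, hn⟩ := mem_iUnion.1 (hcov x.2)
      exact ⟨n, mem_iUnion.2 ⟨∅, by simpa [flipOn_empty] using hn⟩⟩
    obtain ⟨g, hg⟩ := mem_iUnion.1 (Nat.find_spec hex)
    exact ⟨flipOn g x.1, Nat.find hex, ⟨Nat.find_spec hex, fun m hm => Nat.find_min hex hm⟩, hg,
      eZero_flipOn g _⟩
  choose f N hN hf hE using key
  have hNuniq : ∀ (x : X) (n : ℕ), (x.1 ∈ A n ∧ ∀ m < n, x.1 ∉ A m) → n = N x := by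
    intro x n hn
    rcases lt_trichotomy n (N x) with h | h | h
    · exact absurd hn.1 ((hN x).2 _ h)
    · exact h
    · exact absurd (hN x).1 (hn.2 _ h)
  refine ⟨f, fun B hB => ?_, fun x y => ⟨fun h => ?_, fun h => ?_⟩⟩
  · have : f ⁻¹' B = Subtype.val ⁻¹' (⋃ n, ⋃ g,
        (A n \ ⋃ m ∈ Finset.range n, A m) ∩ flipOn g ⁻¹' (T n ∩ B)) := by
      ext x
      simp only [mem_preimage, mem_iUnion, mem_inter_iff, Set.mem_sdiff, Finset.mem_range,
        exists_prop, not_exists, not_and]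
      constructor
      · intro hx
        obtain ⟨g, hg, -⟩ := (hE x).exists_flipOn
        exact ⟨N x, g, hN x, by rw [hg]; exact ⟨hf x, hx⟩⟩
      · rintro ⟨n, g, hn, hg, hgB⟩
        obtain rfl := hNuniq x n hn
        rwa [hinj _ _ (hf x) _ hg ((hE x).symm.trans (eZero_flipOn g _))]
    rw [this]
    refine measurable_subtype_coe (MeasurableSet.iUnion fun n => MeasurableSet.iUnion fun g => ?_)
    exact ((hA n).diff (Finset.measurableSet_biUnion _ fun m _ => hA m)).inter
      (measurable_flipOn g ((hT n).inter hB))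
  · have hNN : N x = N y := hNuniq y _
      ⟨hAinv h _ (hN x).1, fun m hm hy => (hN x).2 m hm (hAinv h.symm _ hy)⟩
    exact hinj _ _ (hf x) _ (hNN ▸ hf y) (((hE x).symm.trans h).trans (hE y))
  · exact (hE x).trans (h ▸ (hE y).symm)

/-- A non-null Borel set has a non-null intersection with its image under some flip of coordinates
beyond any given bound. -/
lemma exists_flipOn_inter_not_null {p : Set Cantor} (hp : MeasurableSet p) (hpn : ¬ E0Null p)
    (m : ℕ) : ∃ g : Finset ℕ, g.Nonempty ∧ (∀ k ∈ g, m ≤ k) ∧ ¬ E0Null (p ∩ flipOn g '' p) := by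
  by_contra! hcon
  let I := {g : Finset ℕ // g.Nonempty ∧ ∀ k ∈ g, m ≤ k}
  let R : Set Cantor := ⋃ g : I, p ∩ flipOn g.1 '' p
  have hR : E0Null R := E0Null.iUnion fun g => hcon g.1 g.2.1 g.2.2
  have hRm : MeasurableSet R :=
    MeasurableSet.iUnion fun g => hp.inter (measurableSet_image_flipOn _ hp)
  let Q : (Fin m → Bool) → Set Cantor := fun s => (p \ R) ∩ {x | (fun i : Fin m => x i) = s}
  have hQ : ∀ s, E0Null (Q s) := by
    intro s
    refine ⟨fun _ => Q s, fun _ => (hp.diff hRm).inter ?_, fun _ x hx y hy hxy => ?_, ?_⟩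
    · exact (measurable_pi_lambda (fun x : Cantor => fun i : Fin m => x i)
        fun i => measurable_pi_apply _) (measurableSet_singleton s)
    · obtain ⟨g, hg, hgk⟩ := hxy.exists_flipOn
      rcases g.eq_empty_or_nonempty with rfl | hne
      · rwa [flipOn_empty] at hg
      refine absurd (show y ∈ R from
        mem_iUnion.2 ⟨⟨g, hne, fun k hk => ?_⟩, hy.1.1, x, hx.1.1, hg⟩) hy.1.2
      by_contra hlt
      exact hgk k hk (congrFun (hx.2.trans hy.2.symm) ⟨k, not_le.1 hlt⟩)
    · exact fun x hx => mem_iUnion.2 ⟨0, hx⟩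
  refine hpn (((E0Null.iUnion hQ).union hR).mono fun x hx => ?_)
  by_cases h : x ∈ R
  · exact Or.inr h
  · exact Or.inl (mem_iUnion.2 ⟨_, ⟨hx, h⟩, rfl⟩)

/-- Finitely many flips of a non-null Borel set can be put inside pieces of a countable cover. -/
lemma exists_subset_flips_subset {W : Set Cantor} {V : ℕ → Set Cantor}
    (hV : ∀ k, MeasurableSet (V k)) (hWV : W ⊆ ⋃ k, V k) (Γ : Finset (Finset ℕ)) :
    ∀ {p : Set Cantor}, MeasurableSet p → ¬ E0Null p → (∀ h ∈ Γ, flipOn h '' p ⊆ W) →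
      ∃ q ⊆ p, MeasurableSet q ∧ ¬ E0Null q ∧ ∀ h ∈ Γ, ∃ k, flipOn h '' q ⊆ V k := by
  classical
  induction Γ using Finset.induction_on with
  | empty => exact fun {p} hp hpn _ => ⟨p, Subset.rfl, hp, hpn, by simp⟩
  | insert h Γ _ ih =>
    intro p hp hpn hpW
    obtain ⟨q, hqp, hq, hqn, hqV⟩ := ih hp hpn fun h' hh' => hpW h' (Finset.mem_insert_of_mem hh')
    have : ∃ k, ¬ E0Null (q ∩ flipOn h ⁻¹' V k) := by
      by_contra! hc
      refine hqn ((E0Null.iUnion hc).mono fun x hx => ?_)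
      obtain ⟨k, hk⟩ := mem_iUnion.1
        (hWV (hpW h (Finset.mem_insert_self _ _) (mem_image_of_mem _ (hqp hx))))
      exact mem_iUnion.2 ⟨k, hx, hk⟩
    obtain ⟨k, hk⟩ := this
    refine ⟨_, inter_subset_left.trans hqp, hq.inter (measurable_flipOn h (hV k)), hk, ?_⟩
    intro h' hh'
    rcases Finset.mem_insert.1 hh' with rfl | hh'
    · exact ⟨k, image_subset_iff.2 inter_subset_right⟩
    · obtain ⟨k', hk'⟩ := hqV h' hh'
      exact ⟨k', (image_mono inter_subset_left).trans hk'⟩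

/-- A Borel set in a Polish space is a continuous injective image of a Polish space. -/
lemma MeasurableSet.exists_polish_injection.{u} {α : Type u} [t : TopologicalSpace α] [PolishSpace α]
    [MeasurableSpace α] [BorelSpace α] {W : Set α} (hW : MeasurableSet W) :
    ∃ (β : Type u) (_ : TopologicalSpace β) (_ : PolishSpace β) (f : β → α),
      Continuous f ∧ Function.Injective f ∧ range f = W := by
  obtain ⟨t', t't, t'_polish, hclosed, -⟩ := hW.isClopenable
  refine ⟨W, @instTopologicalSpaceSubtype α _ t', @IsClosed.polishSpace α t' t'_polish W hclosed,
    Subtype.val, ?_, Subtype.val_injective, Subtype.range_val⟩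
  exact @Continuous.comp W α α (@instTopologicalSpaceSubtype α _ t') t' t Subtype.val id
    (continuous_id_of_le t't) (@continuous_subtype_val α t' (· ∈ W))

/-- Countable Borel covers of a Borel set `W` such that decreasing sequences of subsets of `W`
subordinate to the covers converge to points of `W`. -/
lemma MeasurableSet.exists_complete_sieve {α : Type*} [TopologicalSpace α] [PolishSpace α]
    [MeasurableSpace α] [BorelSpace α] {W : Set α} (hW : MeasurableSet W) :
    ∃ V : ℕ → ℕ → Set α, (∀ n k, MeasurableSet (V n k)) ∧ (∀ n, W ⊆ ⋃ k, V n k) ∧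
      ∀ F : ℕ → Set α, Antitone F → (∀ n, (F n).Nonempty) → (∀ n, F n ⊆ W) →
        (∀ n, ∃ k, F (n + 1) ⊆ V n k) →
        ∃ z ∈ W, ∀ y : ℕ → α, (∀ n, y n ∈ F n) → Tendsto y atTop (𝓝 z) := by
  obtain ⟨β, tβ, hβ, f, hfc, hfi, rfl⟩ := hW.exists_polish_injection
  rcases isEmpty_or_nonempty β with hβe | hβe
  · refine ⟨fun _ _ => ∅, by simp, by simp [hβe], fun F _ hne hsub => ?_⟩
    obtain ⟨x, hx⟩ := hne 0
    obtain ⟨b, -⟩ := hsub 0 hx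
    exact isEmptyElim b
  let _ := TopologicalSpace.upgradeIsCompletelyMetrizable β
  borelize β
  let d := TopologicalSpace.denseSeq β
  let r : ℕ → ℝ := fun n => (1 / 2) ^ n
  have hr0 : Tendsto r atTop (𝓝 0) :=
    tendsto_pow_atTop_nhds_zero_of_lt_one (by norm_num) (by norm_num)
  refine ⟨fun n k => f '' Metric.ball (d k) (r n), fun n k => ?_, fun n => ?_, ?_⟩
  · exact Metric.isOpen_ball.measurableSet.image_of_continuousOn_injOn hfc.continuousOn hfi.injOn
  · rintro _ ⟨b, rfl⟩
    obtain ⟨k, hk⟩ := (TopologicalSpace.denseRange_denseSeq β).exists_dist_lt b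
      (show 0 < r n by positivity)
    exact mem_iUnion.2 ⟨k, b, hk, rfl⟩
  · intro F hF hne hsub hV
    have key : ∀ b : ℕ → β, (∀ n, f (b n) ∈ F n) → ∀ n m m', n + 1 ≤ m → n + 1 ≤ m' →
        ∀ c : β, f c ∈ F m' → dist (b m) c ≤ 2 * r n := by
      intro b hb n m m' hm hm' c hc
      obtain ⟨k, hk⟩ := hV n
      obtain ⟨b1, hb1, e1⟩ := hk (hF hm (hb m))
      obtain ⟨c1, hc1, e2⟩ := hk (hF hm' hc)
      obtain rfl := hfi e1
      obtain rfl := hfi e2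
      have := dist_triangle_right (b m) c1 (d k)
      rw [Metric.mem_ball] at hb1 hc1
      linarith
    choose y0 hy0 using hne
    choose b hb using fun n => hsub n (hy0 n)
    have hbF : ∀ n, f (b n) ∈ F n := fun n => by rw [hb]; exact hy0 n
    have h2r : Tendsto (fun n => 2 * r n) atTop (𝓝 0) := by simpa using hr0.const_mul 2
    have hcau : CauchySeq fun n => b (n + 1) :=
      cauchySeq_of_le_tendsto_0' (fun n => 2 * r n)
        (fun n m hnm => key b hbF n _ (m + 1) le_rfl (by omega) _ (hbF _)) h2r
    obtain ⟨z, hz⟩ := cauchySeq_tendsto_of_complete hcau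
    refine ⟨f z, mem_range_self z, fun y hy => ?_⟩
    choose c hc using fun n => hsub n (hy n)
    have hcF : ∀ n, f (c n) ∈ F n := fun n => by rw [hc]; exact hy n
    have hcz : Tendsto (fun n => c (n + 1)) atTop (𝓝 z) := by
      refine hz.congr_dist (squeeze_zero (fun _ => dist_nonneg) (fun n => ?_) h2r)
      exact key b hbF n _ (n + 1) le_rfl le_rfl _ (hcF _)
    have := (hfc.tendsto z).comp ((tendsto_add_atTop_iff_nat 1).1 hcz)
    simpa [Function.comp_def, hc] using this

lemma xua_eq_of_blocks (U : E0Array) (a w : Cantor) {m : ℕ → ℕ} (h0 : m 0 = 0)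
    (hm : StrictMono m)
    (hU : ∀ n, U.u n (a n) = (List.range' (m n) (m (n + 1) - m n)).map w) : xua U a = w := by
  have key : ∀ n, ((List.range n).map fun i => U.u i (a i)).flatten = (List.range (m n)).map w := by
    intro n
    induction n with
    | zero => simp [h0]
    | succ n ih =>
      have hle : m n ≤ m (n + 1) := (hm n.lt_succ_self).le
      rw [List.range_succ, List.map_append, List.flatten_append, ih, List.map_singleton,
        List.flatten_singleton, hU, ← List.map_append, List.range_eq_range', List.range_eq_range']
      congr 1
      have := List.range'_append_1 (s := 0) (m := m n) (n := m (n + 1) - m n)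
      rwa [Nat.zero_add, Nat.add_sub_cancel' hle] at this
  funext k
  have hk : k < m (k + 1) := (Nat.lt_succ_self k).trans_le (hm.id_le _)
  rw [xua, key, List.getD_eq_getElem _ _ (by simpa using hk)]
  simp

/-- The symmetric difference of those `g i` with `i < n` and `a i = true`. -/
def partialFlip (g : ℕ → Finset ℕ) (a : Cantor) : ℕ → Finset ℕ
  | 0 => ∅
  | n + 1 => if a n then symmDiff (partialFlip g a n) (g n) else partialFlip g a n

lemma mem_partialFlip_iff {g : ℕ → Finset ℕ} {m : ℕ → ℕ} (hm : StrictMono m)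
    (hg : ∀ n, ∀ k ∈ g n, m n ≤ k ∧ k < m (n + 1)) (a : Cantor) {j k : ℕ} (h1 : m j ≤ k)
    (h2 : k < m (j + 1)) (n : ℕ) :
    k ∈ partialFlip g a n ↔ j < n ∧ a j = true ∧ k ∈ g j := by
  have hj : ∀ n, k ∈ g n → n = j := by
    intro n hn
    have := hg n k hn
    have h3 := hm.lt_iff_lt.1 (this.1.trans_lt h2)
    have h4 := hm.lt_iff_lt.1 (h1.trans_lt this.2)
    omega
  induction n with
  | zero => simp [partialFlip]
  | succ n ih =>
    rcases eq_or_ne n j with rfl | hne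
    · by_cases ha : a n = true <;> simp [partialFlip, ha, Finset.mem_symmDiff, ih]
    · have h5 : k ∉ g n := fun h => hne (hj n h)
      have h6 : j < n + 1 ↔ j < n := by omega
      by_cases ha : a n = true <;> simp [partialFlip, ha, Finset.mem_symmDiff, ih, h5, h6]

/-- A Borel set which is not null contains a canonical `E₀`-large set. -/
lemma exists_Du_subset {W : Set Cantor} (hW : MeasurableSet W) (hWn : ¬ E0Null W) :
    ∃ U : E0Array, Du U ⊆ W := by
  classical
  have : PolishSpace Cantor := {}
  obtain ⟨V, hV, hWV, hlim⟩ := hW.exists_complete_sieve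
  let S := {s : Set Cantor × ℕ × Finset (Finset ℕ) //
    MeasurableSet s.1 ∧ ¬ E0Null s.1 ∧ ∀ h ∈ s.2.2, flipOn h '' s.1 ⊆ W}
  have step : ∀ (n : ℕ) (s : S), ∃ (s' : S) (g : Finset ℕ), g.Nonempty ∧
      (∀ k ∈ g, s.1.2.1 ≤ k ∧ k < s'.1.2.1) ∧ s'.1.1 ⊆ s.1.1 ∧ flipOn g '' s'.1.1 ⊆ s.1.1 ∧
      s'.1.2.2 = s.1.2.2 ∪ s.1.2.2.image (fun h => symmDiff h g) ∧
      ∀ h ∈ s'.1.2.2, ∃ k, flipOn h '' s'.1.1 ⊆ V n k := by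
    rintro n ⟨⟨p, m, Γ⟩, hp, hpn, hpW⟩
    dsimp only at hp hpn hpW ⊢
    obtain ⟨g, hgne, hgm, hgn⟩ := exists_flipOn_inter_not_null hp hpn m
    have hsub : flipOn g '' (p ∩ flipOn g '' p) ⊆ p := by
      rintro _ ⟨_, ⟨-, x, hx, rfl⟩, rfl⟩
      rwa [flipOn_flipOn]
    have hΓ : ∀ h ∈ Γ ∪ Γ.image (fun h => symmDiff h g),
        flipOn h '' (p ∩ flipOn g '' p) ⊆ W := by
      intro h hh
      rcases Finset.mem_union.1 hh with hh | hh
      · exact (image_mono inter_subset_left).trans (hpW h hh)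
      · obtain ⟨h', hh', rfl⟩ := Finset.mem_image.1 hh
        rintro _ ⟨x, hx, rfl⟩
        rw [flipOn_symmDiff]
        exact hpW h' hh' (mem_image_of_mem _ (hsub (mem_image_of_mem _ hx)))
    obtain ⟨q, hqp, hq, hqn, hqV⟩ := exists_subset_flips_subset (hV n) (hWV n) _
      (hp.inter (measurableSet_image_flipOn g hp)) hgn hΓ
    refine ⟨⟨⟨q, g.sup id + 1, Γ ∪ Γ.image (fun h => symmDiff h g)⟩, hq, hqn,
      fun h hh => (image_mono hqp).trans (hΓ h hh)⟩, g, hgne, fun k hk => ⟨hgm k hk, ?_⟩,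
      hqp.trans inter_subset_left, (image_mono hqp).trans hsub, rfl, hqV⟩
    exact Nat.lt_succ_of_le (Finset.le_sup (f := id) hk)
  choose next g' hne hbd hsub hflip hΓ hVn using step
  let s0 : S := ⟨⟨W, 0, {∅}⟩, hW, hWn, by simp [preimage, flipOn_empty]⟩
  let s : ℕ → S := fun n => Nat.rec s0 (fun n t => next n t) n
  let p : ℕ → Set Cantor := fun n => (s n).1.1
  let m : ℕ → ℕ := fun n => (s n).1.2.1
  let g : ℕ → Finset ℕ := fun n => g' n (s n)
  have hg : ∀ n, ∀ k ∈ g n, m n ≤ k ∧ k < m (n + 1) := fun n => hbd n (s n)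
  have hgne : ∀ n, (g n).Nonempty := fun n => hne n (s n)
  have hm : StrictMono m := strictMono_nat_of_lt_succ fun n => by
    obtain ⟨k, hk⟩ := hgne n
    exact (hg n k hk).1.trans_lt (hg n k hk).2
  have hmem : ∀ a n, partialFlip g a n ∈ (s n).1.2.2 := by
    intro a n
    induction n with
    | zero => exact Finset.mem_singleton_self _
    | succ n ih =>
      rw [show (s (n + 1)).1.2.2 = _ from hΓ n (s n), partialFlip]
      split_ifs
      · exact Finset.mem_union_right _ (Finset.mem_image_of_mem _ ih)
      · exact Finset.mem_union_left _ ih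
  have hpne : ∀ n, (p n).Nonempty := by
    intro n
    by_contra h
    refine (s n).2.2.1 (E0Null.mono (B := ∅) ⟨fun _ => ∅, by simp, by simp, by simp⟩ ?_)
    exact (not_nonempty_iff_eq_empty.1 h).subset
  have hlim' : ∀ a, ∃ z ∈ W, ∀ y : ℕ → Cantor,
      (∀ n, y n ∈ flipOn (partialFlip g a n) '' p n) → Tendsto y atTop (𝓝 z) := by
    intro a
    refine hlim _ (antitone_nat_of_succ_le fun n => ?_) (fun n => (hpne n).image _)
      (fun n => (s n).2.2.2 _ (hmem a n)) (fun n => hVn n (s n) _ (hmem a (n + 1)))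
    rintro _ ⟨x, hx, rfl⟩
    rw [partialFlip]
    split_ifs
    · rw [flipOn_symmDiff]
      exact mem_image_of_mem _ (hflip n (s n) (mem_image_of_mem _ hx))
    · exact mem_image_of_mem _ (hsub n (s n) hx)
  choose y hy using hpne
  choose z hzW hz using hlim'
  let o : Cantor := fun _ => false
  have ho : ∀ n, partialFlip g o n = ∅ := by
    intro n
    induction n with
    | zero => rfl
    | succ n ih => simpa [partialFlip, o] using ih
  have hzo : Tendsto y atTop (𝓝 (z o)) :=
    hz o y fun n => ⟨y n, hy n, by rw [ho, flipOn_empty]⟩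
  have hza : ∀ a j k, m j ≤ k → k < m (j + 1) →
      z a k = xor (z o k) (a j && decide (k ∈ g j)) := by
    intro a j k h1 h2
    have t1 := tendsto_pi_nhds.1 (hz a _ fun n => mem_image_of_mem _ (hy n)) k
    have t2 := tendsto_pi_nhds.1 hzo k
    rw [nhds_discrete, tendsto_pure] at t1 t2
    obtain ⟨n, e1, e2, hn⟩ := (t1.and (t2.and (eventually_gt_atTop j))).exists
    rw [← e1, ← e2, flipOn]
    congr 1
    rw [Bool.eq_iff_iff]
    simp [mem_partialFlip_iff hm hg a h1 h2 n, hn]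
  let U : E0Array :=
    { u := fun n i => (List.range' (m n) (m (n + 1) - m n)).map
        fun k => xor (z o k) (i && decide (k ∈ g n))
      len_eq := by simp
      len_pos := fun n => by
        have : m n < m (n + 1) := hm n.lt_succ_self
        simp only [List.length_map, List.length_range']
        omega
      ne := fun n h => by
        obtain ⟨k, hk⟩ := hgne n
        have hb := hg n k hk
        have := List.map_inj_left.1 h k (List.mem_range'_1.2 ⟨hb.1, by omega⟩)
        simp [hk] at this }
  refine ⟨U, ?_⟩
  rintro _ ⟨a, rfl⟩
  rw [xua_eq_of_blocks U a (z a) (m := m) rfl hm fun n => ?_]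
  · exact hzW a
  · refine List.map_congr_left fun k hk => ?_
    have hk' := List.mem_range'_1.1 hk
    exact (hza a n k hk'.1 (by omega)).symm

/-- If `X` is a Borel `E₀`-large set and `Z ⊆ X` is Borel, then some canonical
`E₀`-large subset of `X` is contained in `Z` or disjoint from `Z`. -/
theorem e0large_split (X : Set Cantor) (hX : MeasurableSet X) (hXl : E0Large X)
    (Z : Set Cantor) (hZ : MeasurableSet Z) (hZX : Z ⊆ X) :
    ∃ U : E0Array, Du U ⊆ X ∧ (Du U ⊆ Z ∨ Du U ∩ Z = ∅) := by
  have hXn : ¬ E0Null X := fun h => hXl h.relSmoothOn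
  by_cases hZn : E0Null Z
  · obtain ⟨U, hU⟩ := exists_Du_subset (hX.diff hZ) fun h =>
      hXn ((hZn.union h).mono fun x hx => or_iff_not_imp_left.2 fun hxZ => ⟨hx, hxZ⟩)
    refine ⟨U, hU.trans sdiff_subset, Or.inr ?_⟩
    exact disjoint_iff_inter_eq_empty.1 (disjoint_sdiff_left.mono_left hU)
  · obtain ⟨U, hU⟩ := exists_Du_subset hZ hZn
    exact ⟨U, hU.trans hZX, Or.inl hU⟩
end
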